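/- arXiv:1805.05224 — 5 statements merged into one kernel-verified Lean document; each statement's English description precedes it below -/
import Mathlib

section
/- Let n ≥ 1 and let f₀ : 𝔽₂ⁿ → 𝔽₂ be a Boolean function that is not balanced (gap(f₀) ≠ 0). Then for every subset S ⊆ 𝔽₂ⁿ with |S| ≤ 2^{n−1} there exists a balanced Boolean function f₁ : 𝔽₂ⁿ → 𝔽₂ (gap(f₁) = 0) that agrees with f₀ on S, i.e. f₁(x) = f₀(x) for all x ∈ S. -/
/-- The gap of a Boolean function `f : 𝔽₂ⁿ → 𝔽₂`:
`gap f = ∑_x (−1)^{f(x)}`, i.e. `+1` for each `x` with `f x = 0` and `−1` otherwise. -/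
def gap {n : ℕ} (f : (Fin n → ZMod 2) → ZMod 2) : ℤ :=
  ∑ x : Fin n → ZMod 2, if f x = 0 then 1 else -1

/-- A Boolean function on `n` bits vanishing at exactly half of the inputs is balanced. -/
theorem gap_indicator_compl {n : ℕ} (hn : 1 ≤ n) (u : Finset (Fin n → ZMod 2))
    (hu : u.card = 2 ^ (n - 1)) : gap (fun x => if x ∈ u then 0 else 1) = 0 := by
  obtain ⟨m, rfl⟩ := Nat.exists_eq_add_of_le' hn
  have hc : uᶜ.card = 2 ^ m := by
    rw [Finset.card_compl, hu]
    simp [pow_succ]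
    lia
  have h : ∀ x, (if (if x ∈ u then (0 : ZMod 2) else 1) = 0 then (1 : ℤ) else -1) =
      if x ∈ u then 1 else -1 := by
    intro x
    split_ifs <;> simp_all
  unfold gap
  simp only [h]
  rw [← Finset.sum_add_sum_compl u, Finset.sum_congr rfl (g := fun _ => (1 : ℤ)),
    Finset.sum_congr (s₁ := uᶜ) rfl (g := fun _ => (-1 : ℤ))]
  · simp only [Finset.sum_const, hu, hc]
    simp
  · intro x hx
    exact if_neg (Finset.mem_compl.mp hx)
  · intro x hx
    exact if_pos hx

/-- if `f₀` is not balanced and `S` has at most `2^(n-1)` elements, there is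
a balanced `f₁` agreeing with `f₀` on `S`. -/
theorem stmt0 (n : ℕ) (hn : 1 ≤ n) (f₀ : (Fin n → ZMod 2) → ZMod 2)
    (hf₀ : gap f₀ ≠ 0) (S : Finset (Fin n → ZMod 2)) (hS : S.card ≤ 2 ^ (n - 1)) :
    ∃ f₁ : (Fin n → ZMod 2) → ZMod 2, gap f₁ = 0 ∧ ∀ x ∈ S, f₁ x = f₀ x := by
  have hle : (S.filter (f₀ · = 0)).card ≤ 2 ^ (n - 1) :=
    (Finset.card_filter_le _ _).trans hS
  have hge : 2 ^ (n - 1) ≤ (S.filter (f₀ · ≠ 0))ᶜ.card := by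
    have h := (Finset.card_filter_le S (f₀ · ≠ 0)).trans hS
    obtain ⟨m, rfl⟩ := Nat.exists_eq_add_of_le' hn
    rw [Finset.card_compl]
    simp [pow_succ] at h ⊢
    lia
  have hsub : S.filter (f₀ · = 0) ⊆ (S.filter (f₀ · ≠ 0))ᶜ := by
    intro x hx
    simp_all
  obtain ⟨u, hsu, hut, hu⟩ := Finset.exists_subsuperset_card_eq hsub hle hge
  refine ⟨fun x => if x ∈ u then 0 else 1, gap_indicator_compl hn u hu, fun x hx => ?_⟩
  by_cases h : f₀ x = 0
  · simp [h, hsu (Finset.mem_filter.mpr ⟨hx, h⟩)]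
  · have hxu : x ∉ u := fun hxu =>
      Finset.mem_compl.mp (hut hxu) (Finset.mem_filter.mpr ⟨hx, h⟩)
    simp only [if_neg hxu]
    exact (Fin.eq_one_of_ne_zero (f₀ x) h).symm
end

section
/- Let H be an 𝔽₂-linear subspace of 𝔽₂^{2k}. Then dim H = k and H^× ⊆ H^⊥ if and only if there exists a partition of the 2k coordinate indices into k pairs such that H = { u ∈ 𝔽₂^{2k} : u_a = u_b for every pair {a,b} of the partition }. Moreover, in this case H = H^⊥ = H^× and the all-ones vector 𝟏 lies in H. -/
/-- The "orthogonal complement" set of a subspace `H ⊆ 𝔽₂^m` with respect to the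
bilinear form `⟨u,v⟩ = ∑_j u_j v_j`. -/
def perpSet {m : ℕ} (H : Submodule (ZMod 2) (Fin m → ZMod 2)) : Set (Fin m → ZMod 2) :=
  {v | ∀ u ∈ H, ∑ j, u j * v j = 0}

/-- `H^×`: the 𝔽₂-linear span of entrywise products `u × v` of pairs of elements of `H`
(here `u * v` is the entrywise product in the ring `Fin m → ZMod 2`). -/
def crossSpan {m : ℕ} (H : Submodule (ZMod 2) (Fin m → ZMod 2)) :
    Submodule (ZMod 2) (Fin m → ZMod 2) :=
  Submodule.span (ZMod 2) {w | ∃ u ∈ H, ∃ v ∈ H, w = u * v}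

/-- The dot product on `𝔽₂^m` as a bilinear form. -/
def dotForm (m : ℕ) : LinearMap.BilinForm (ZMod 2) (Fin m → ZMod 2) :=
  dotProductBilin (ZMod 2) (ZMod 2)

theorem dotForm_apply {m : ℕ} (u v : Fin m → ZMod 2) : dotForm m u v = ∑ j, u j * v j := rfl

theorem dotForm_isSymm (m : ℕ) : (dotForm m).IsSymm :=
  ⟨fun u v => by simp [dotForm_apply, mul_comm]⟩

theorem dotForm_nondegenerate (m : ℕ) : (dotForm m).Nondegenerate := by
  refine (dotForm_isSymm m).isRefl.nondegenerate_iff_separatingLeft.mpr ?_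
  intro u hu
  ext a
  simpa [dotForm_apply, Pi.single_apply] using hu (Pi.single a 1)

theorem finrank_orthogonal_dotForm {m : ℕ} (H : Submodule (ZMod 2) (Fin m → ZMod 2)) :
    Module.finrank (ZMod 2) ((dotForm m).orthogonal H) = m - Module.finrank (ZMod 2) H := by
  simpa using LinearMap.BilinForm.finrank_orthogonal (dotForm_nondegenerate m) H

theorem mul_self_zmod_two (x : ZMod 2) : x * x = x := by
  revert x
  decide

theorem le_crossSpan {m : ℕ} (H : Submodule (ZMod 2) (Fin m → ZMod 2)) : H ≤ crossSpan H := by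
  refine fun u hu => Submodule.subset_span ⟨u, hu, u, hu, ?_⟩
  ext j
  exact (mul_self_zmod_two (u j)).symm

theorem mul_mem_crossSpan {m : ℕ} {H : Submodule (ZMod 2) (Fin m → ZMod 2)}
    {u v : Fin m → ZMod 2} (hu : u ∈ H) (hv : v ∈ H) : u * v ∈ crossSpan H :=
  Submodule.subset_span ⟨u, hu, v, hv, rfl⟩

/-- A subspace of half the dimension with `H^× ⊆ H^⊥` satisfies `H = H^⊥ = H^×` and contains
the all-ones vector. -/
theorem eq_perp_of_crossSpan_subset {k : ℕ} {H : Submodule (ZMod 2) (Fin (2 * k) → ZMod 2)}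
    (hk : Module.finrank (ZMod 2) H = k)
    (hH : (crossSpan H : Set (Fin (2 * k) → ZMod 2)) ⊆ perpSet H) :
    (H : Set (Fin (2 * k) → ZMod 2)) = perpSet H ∧ crossSpan H = H ∧
      (1 : Fin (2 * k) → ZMod 2) ∈ H := by
  have hle : crossSpan H ≤ (dotForm (2 * k)).orthogonal H := hH
  have heq : H = (dotForm (2 * k)).orthogonal H := by
    refine Submodule.eq_of_le_of_finrank_eq ((le_crossSpan H).trans hle) ?_
    rw [finrank_orthogonal_dotForm, hk]
    omega
  have hperp : (H : Set (Fin (2 * k) → ZMod 2)) = perpSet H :=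
    congrArg SetLike.coe heq
  refine ⟨hperp, le_antisymm (hle.trans heq.ge) (le_crossSpan H), ?_⟩
  rw [← SetLike.mem_coe, hperp]
  intro u hu
  have := hH (le_crossSpan H hu) u hu
  simpa [mul_self_zmod_two] using this

/-- Pairing off the coordinates, a sum of `σ`-invariant terms vanishes in characteristic two. -/
theorem sum_eq_zero_of_involutive {ι : Type*} [Fintype ι] {σ : ι → ι}
    (hσ : Function.Involutive σ) (hne : ∀ a, σ a ≠ a) {f : ι → ZMod 2}
    (hf : ∀ a, f a = f (σ a)) : ∑ j, f j = 0 :=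
  Finset.sum_involution (fun a _ => σ a) (fun a _ => by rw [← hf a, CharTwo.add_self_eq_zero])
    (fun a _ _ => hne a) (fun a _ => Finset.mem_univ _) (fun a _ => hσ a)

section Pairs

variable {m : ℕ} {H : Submodule (ZMod 2) (Fin m → ZMod 2)}

/-- In a self-orthogonal subspace closed under products and containing `1`, no coordinate is
separated by the subspace from all the other ones. -/
theorem exists_ne_forall_apply_eq (hperp : (H : Set (Fin m → ZMod 2)) ⊆ perpSet H)
    (hmul : ∀ u ∈ H, ∀ v ∈ H, u * v ∈ H) (hone : 1 ∈ H) (a : Fin m) :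
    ∃ b, b ≠ a ∧ ∀ u ∈ H, u a = u b := by
  by_contra! hcon
  have hsep : ∀ b, ∃ w ∈ H, w a = 1 ∧ (b ≠ a → w b = 0) := by
    intro b
    by_cases hb : b = a
    · exact ⟨1, hone, rfl, fun h => absurd hb h⟩
    · obtain ⟨u, hu, hab⟩ := hcon b hb
      refine ⟨u + u b • 1, H.add_mem hu (H.smul_mem _ hone), ?_, fun _ => ?_⟩
      · have : ∀ x y : ZMod 2, x ≠ y → x + y = 1 := by decide
        simpa using this _ _ hab
      · simpa using CharTwo.add_self_eq_zero (u b)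
  choose w hwH hwa hwb using hsep
  let S : Submonoid (Fin m → ZMod 2) :=
    { carrier := H
      mul_mem' := fun hu hv => hmul _ hu _ hv
      one_mem' := hone }
  have hsingle : ∏ b, w b = Pi.single a 1 := by
    ext c
    rw [Finset.prod_apply]
    by_cases hc : c = a
    · subst hc
      simp [hwa]
    · rw [Pi.single_eq_of_ne hc]
      exact Finset.prod_eq_zero (Finset.mem_univ c) (hwb c hc)
  have hmem : Pi.single a 1 ∈ H := hsingle ▸ S.prod_mem fun b _ => hwH b
  simpa [Pi.single_apply] using hperp hmem _ hmem

/-- A pair of coordinates on which all vectors of `H` agree is a full class of coordinates, as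
soon as `H^⊥ ⊆ H`. -/
theorem eq_or_eq_of_forall_apply_eq (hperp : perpSet H ⊆ H) {a b c : Fin m} (hba : b ≠ a)
    (hab : ∀ u ∈ H, u a = u b) (hac : ∀ u ∈ H, u a = u c) : c = a ∨ c = b := by
  by_contra! hc
  have hmem : (Pi.single a 1 + Pi.single b 1 : Fin m → ZMod 2) ∈ H := by
    refine hperp fun u hu => ?_
    simp [mul_add, Finset.sum_add_distrib, Pi.single_apply, hab u hu,
      CharTwo.add_self_eq_zero]
  have := hac _ hmem
  simp [hba.symm, hc.1, hc.2] at this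

/-- The subspace attached to a fixed-point-free involution is its own orthogonal complement. -/
theorem eq_perpSet_of_involutive {σ : Equiv.Perm (Fin m)} (hσ : Function.Involutive σ)
    (hne : ∀ a, σ a ≠ a) (hH : (H : Set (Fin m → ZMod 2)) = {u | ∀ a, u a = u (σ a)}) :
    (H : Set (Fin m → ZMod 2)) = perpSet H := by
  have hmem : ∀ u, u ∈ H ↔ ∀ a, u a = u (σ a) := fun u => Set.ext_iff.mp hH u
  ext v
  rw [SetLike.mem_coe]
  constructor
  · intro hv u hu
    refine sum_eq_zero_of_involutive hσ hne fun a => ?_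
    rw [(hmem u).1 hu a, (hmem v).1 hv a]
  · intro hv
    rw [hmem]
    intro a
    have hpair : (Pi.single a 1 + Pi.single (σ a) 1 : Fin m → ZMod 2) ∈ H := by
      rw [hmem]
      intro c
      simp only [Pi.add_apply, Pi.single_apply, hσ.eq_iff, hσ a]
      rw [add_comm]
    have := hv _ hpair
    simp only [Pi.add_apply, add_mul, Finset.sum_add_distrib, Pi.single_apply, ite_mul, one_mul,
      zero_mul, Finset.sum_ite_eq', Finset.mem_univ, if_true] at this
    exact CharTwo.add_eq_zero.mp this

end Pairs

/-- A subspace with `H = H^⊥`, closed under products and containing `1`, is given by a pairing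
of the coordinates. -/
theorem exists_involutive_of_eq_perpSet {m : ℕ} {H : Submodule (ZMod 2) (Fin m → ZMod 2)}
    (hperp : (H : Set (Fin m → ZMod 2)) = perpSet H)
    (hmul : ∀ u ∈ H, ∀ v ∈ H, u * v ∈ H) (hone : 1 ∈ H) :
    ∃ σ : Equiv.Perm (Fin m), Function.Involutive σ ∧ (∀ a, σ a ≠ a) ∧
      (H : Set (Fin m → ZMod 2)) = {u | ∀ a, u a = u (σ a)} := by
  choose s hne hs using exists_ne_forall_apply_eq hperp.subset hmul hone
  have hinv : Function.Involutive s := fun a =>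
    (eq_or_eq_of_forall_apply_eq hperp.superset (hne a) (hs a)
      fun u hu => (hs a u hu).trans (hs (s a) u hu)).resolve_right (hne (s a))
  refine ⟨hinv.toPerm s, hinv, hne, Set.Subset.antisymm (fun u hu a => hs a u hu) fun u hu => ?_⟩
  rw [hperp]
  exact fun v hv => sum_eq_zero_of_involutive hinv hne fun a => by rw [hs a v hv, hu a]; rfl

/-- a subspace `H ⊆ 𝔽₂^{2k}` has `dim H = k` and `H^× ⊆ H^⊥` iff the `2k`
coordinates partition into `k` pairs (encoded by a fixed-point-free involution `σ`) with
`H = {u : u_a = u_{σ a} for all a}`.  Moreover, in that case `H = H^⊥ = H^×` and `𝟏 ∈ H`. -/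
theorem stmt5 (k : ℕ) (H : Submodule (ZMod 2) (Fin (2 * k) → ZMod 2)) :
    ((Module.finrank (ZMod 2) H = k ∧
        (↑(crossSpan H) : Set (Fin (2 * k) → ZMod 2)) ⊆ perpSet H) ↔
      ∃ σ : Equiv.Perm (Fin (2 * k)), Function.Involutive σ ∧ (∀ a, σ a ≠ a) ∧
        (H : Set (Fin (2 * k) → ZMod 2)) = {u | ∀ a, u a = u (σ a)}) ∧
    ((Module.finrank (ZMod 2) H = k ∧
        (↑(crossSpan H) : Set (Fin (2 * k) → ZMod 2)) ⊆ perpSet H) →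
      (H : Set (Fin (2 * k) → ZMod 2)) = perpSet H ∧ crossSpan H = H ∧
        (1 : Fin (2 * k) → ZMod 2) ∈ H) := by
  refine ⟨⟨fun ⟨hk, hH⟩ => ?_, fun ⟨σ, hσ, hne, hH⟩ => ?_⟩,
    fun ⟨hk, hH⟩ => eq_perp_of_crossSpan_subset hk hH⟩
  · obtain ⟨hperp, hcross, hone⟩ := eq_perp_of_crossSpan_subset hk hH
    exact exists_involutive_of_eq_perpSet hperp
      (fun u hu v hv => hcross.le (mul_mem_crossSpan hu hv)) hone
  · have hperp := eq_perpSet_of_involutive hσ hne hH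
    constructor
    · have heq : H = (dotForm (2 * k)).orthogonal H := SetLike.coe_injective hperp
      have hle : Module.finrank (ZMod 2) H ≤ 2 * k := by simpa using H.finrank_le
      have hrank := finrank_orthogonal_dotForm H
      rw [← heq] at hrank
      omega
    · rw [← hperp, SetLike.coe_subset_coe, crossSpan, Submodule.span_le]
      rintro _ ⟨u, hu, v, hv, rfl⟩
      rw [← SetLike.mem_coe, hH] at hu hv
      rw [hH]
      exact fun a => congrArg₂ (· * ·) (hu a) (hv a)
end

section
/- For every k ≥ 1, the number of 𝔽₂-linear subspaces H of 𝔽₂^{2k} with dim H = k and H^× ⊆ H^⊥ equals (2k−1)!! = ∏_{i=1}^{k} (2i−1), the number of ways to partition 2k indices into k unordered pairs. -/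
section SelfDual

variable {ι K : Type*} [Fintype ι] [Field K]

/-- The orthogonal complement for the standard dot product, as a subspace. -/
noncomputable def dotOrthogonal (H : Submodule K (ι → K)) : Submodule K (ι → K) :=
  open Classical in (Matrix.toBilin' (1 : Matrix ι ι K)).orthogonal H

lemma mem_dotOrthogonal {H : Submodule K (ι → K)} {v : ι → K} :
    v ∈ dotOrthogonal H ↔ ∀ u ∈ H, ∑ j, u j * v j = 0 := by
  classical
  simp [dotOrthogonal, LinearMap.BilinForm.mem_orthogonal_iff,
    Matrix.toBilin'_apply', dotProduct]

lemma finrank_dotOrthogonal (H : Submodule K (ι → K)) :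
    Module.finrank K (dotOrthogonal H) = Fintype.card ι - Module.finrank K H := by
  classical
  rw [dotOrthogonal, LinearMap.BilinForm.finrank_orthogonal
    (LinearMap.BilinForm.nondegenerate_toBilin'_of_det_ne_zero' _ (by simp)),
    Module.finrank_fintype_fun_eq_card]

/-- A totally isotropic subspace of half the dimension is its own orthogonal complement. -/
lemma eq_dotOrthogonal_of_le {H : Submodule K (ι → K)} (h : H ≤ dotOrthogonal H)
    (hd : 2 * Module.finrank K H = Fintype.card ι) : H = dotOrthogonal H :=
  Submodule.eq_of_le_of_finrank_eq h (by rw [finrank_dotOrthogonal]; omega)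

end SelfDual

section PairSubspace

variable {ι : Type*}

/-- The vectors which are constant on the orbits of a permutation. -/
def invariantVectors (σ : Equiv.Perm ι) : Submodule (ZMod 2) (ι → ZMod 2) where
  carrier := {v | ∀ i, v (σ i) = v i}
  add_mem' hu hv i := by simp [hu i, hv i]
  zero_mem' _ := rfl
  smul_mem' c v hv i := by simp [hv i]

lemma mem_invariantVectors {σ : Equiv.Perm ι} {v : ι → ZMod 2} :
    v ∈ invariantVectors σ ↔ ∀ i, v (σ i) = v i := Iff.rfl

lemma mul_mem_invariantVectors {σ : Equiv.Perm ι} {u v : ι → ZMod 2}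
    (hu : u ∈ invariantVectors σ) (hv : v ∈ invariantVectors σ) :
    u * v ∈ invariantVectors σ := fun i => by simp [hu i, hv i]

lemma invariantVectors_injOn :
    Set.InjOn invariantVectors {σ : Equiv.Perm ι | (∀ i, σ (σ i) = i) ∧ ∀ i, σ i ≠ i} := by
  classical
  rintro σ ⟨hσ, -⟩ τ ⟨-, hτ⟩ h
  ext i
  let v : ι → ZMod 2 := fun j => if j = i ∨ j = σ i then 1 else 0
  have hv : v ∈ invariantVectors σ := fun j => by
    have : σ j = i ↔ j = σ i := ⟨fun h => by rw [← h, hσ], fun h => by rw [h, hσ]⟩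
    simp [v, this, or_comm]
  rw [h] at hv
  have := hv i
  simp only [v, true_or, if_true] at this
  by_contra hne
  rw [if_neg (by simp [hτ i, Ne.symm hne])] at this
  exact zero_ne_one this

variable [Fintype ι]

lemma sum_eq_zero_of_mem_invariantVectors {σ : Equiv.Perm ι} (hσ : ∀ i, σ (σ i) = i)
    (hfix : ∀ i, σ i ≠ i) {v : ι → ZMod 2} (hv : v ∈ invariantVectors σ) : ∑ i, v i = 0 :=
  Finset.sum_ninvolution σ (fun i => by rw [hv i, CharTwo.add_self_eq_zero])
    (fun i _ => hfix i) (fun _ => Finset.mem_univ _) hσ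

lemma two_mul_finrank_invariantVectors {σ : Equiv.Perm ι} (hσ : ∀ i, σ (σ i) = i)
    (hfix : ∀ i, σ i ≠ i) :
    2 * Module.finrank (ZMod 2) (invariantVectors σ) = Fintype.card ι := by
  have hle : invariantVectors σ ≤ dotOrthogonal (invariantVectors σ) := fun v hv =>
    mem_dotOrthogonal.2 fun u hu =>
      sum_eq_zero_of_mem_invariantVectors hσ hfix (mul_mem_invariantVectors hu hv)
  have h1 := Submodule.finrank_mono hle
  rw [finrank_dotOrthogonal] at h1
  let f : (ι → ZMod 2) →ₗ[ZMod 2] (ι → ZMod 2) := LinearMap.funLeft _ _ σ + LinearMap.id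
  have hf : ∀ v i, f v i = v (σ i) + v i := fun v i => rfl
  have hker : LinearMap.ker f = invariantVectors σ := by
    ext v
    simp only [LinearMap.mem_ker, mem_invariantVectors, funext_iff, hf, Pi.zero_apply,
      CharTwo.add_eq_zero]
  have hrange : LinearMap.range f ≤ invariantVectors σ := by
    rintro _ ⟨v, rfl⟩ i
    rw [hf, hf, hσ, add_comm]
  have h2 := Submodule.finrank_mono hrange
  have h3 := f.finrank_range_add_finrank_ker
  rw [hker, Module.finrank_fintype_fun_eq_card] at h3
  have h4 := Submodule.finrank_le (invariantVectors σ)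
  rw [Module.finrank_fintype_fun_eq_card] at h4
  omega

lemma exists_eq_invariantVectors {H : Submodule (ZMod 2) (ι → ZMod 2)}
    (hd : 2 * Module.finrank (ZMod 2) H = Fintype.card ι)
    (hH : ∀ u ∈ H, ∀ v ∈ H, ∀ w ∈ H, ∑ j, w j * (u j * v j) = 0) :
    ∃ σ : Equiv.Perm ι, ((∀ i, σ (σ i) = i) ∧ ∀ i, σ i ≠ i) ∧ invariantVectors σ = H := by
  classical
  have hsq : ∀ a : ZMod 2, a * a = a := by decide
  have hiso : H = dotOrthogonal H := eq_dotOrthogonal_of_le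
    (fun v hv => mem_dotOrthogonal.2 fun u hu => by simpa [hsq] using hH v hv v hv u hu) hd
  have hmem : ∀ {v}, (∀ u ∈ H, ∑ j, u j * v j = 0) → v ∈ H := fun h =>
    hiso ▸ mem_dotOrthogonal.2 h
  have hmul : ∀ u v, u ∈ H → v ∈ H → u * v ∈ H := fun u v hu hv => hmem fun w hw =>
    hH u hu v hv w hw
  have hone : (1 : ι → ZMod 2) ∈ H := hmem fun u hu => by simpa [hsq] using hH u hu u hu u hu
  have hpartner : ∀ i, ∃ j ≠ i, ∀ v ∈ H, v j = v i := by
    intro i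
    by_contra! hcon
    have hsep : ∀ j, ∃ v ∈ H, v i = 1 ∧ (j ≠ i → v j = 0) := by
      intro j
      by_cases hj : j = i
      · exact ⟨1, hone, rfl, fun h => (h hj).elim⟩
      · obtain ⟨v, hv, hne⟩ := hcon j hj
        have h2 : ∀ a b : ZMod 2, a ≠ b → (b = 1 ∧ a = 0) ∨ (1 + b = 1 ∧ 1 + a = 0) := by decide
        rcases h2 _ _ hne with h | h
        · exact ⟨v, hv, h.1, fun _ => h.2⟩
        · exact ⟨1 + v, H.add_mem hone hv, h.1, fun _ => h.2⟩
    choose g hg hgi hgj using hsep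
    have hprod : ∏ j, g j ∈ H := Finset.prod_induction g (· ∈ H) hmul hone fun j _ => hg j
    have hsingle : ∏ j, g j = Pi.single i 1 := by
      ext l
      rw [Finset.prod_apply]
      by_cases hl : l = i
      · subst hl; simp [hgi]
      · rw [Pi.single_eq_of_ne hl]
        exact Finset.prod_eq_zero (Finset.mem_univ l) (hgj l hl)
    have := hH 1 hone 1 hone _ hprod
    rw [hsingle] at this
    simp at this
  choose s hs hsH using hpartner
  have huniq : ∀ i l, l ≠ i → (∀ v ∈ H, v l = v i) → l = s i := by
    intro i l hl hlH
    by_contra hne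
    have hpair : (Pi.single i 1 + Pi.single (s i) 1 : ι → ZMod 2) ∈ H := hmem fun u hu => by
      simp [mul_add, Finset.sum_add_distrib, Pi.single_apply, hsH i u hu,
        CharTwo.add_self_eq_zero]
    have := hlH _ hpair
    simp [hl, hne, (hs i).symm] at this
  have hss : ∀ i, s (s i) = i := fun i =>
    (huniq (s i) i (hs i).symm fun v hv => (hsH i v hv).symm).symm
  refine ⟨⟨s, s, hss, hss⟩, ⟨hss, hs⟩, ?_⟩
  refine (Submodule.eq_of_le_of_finrank_eq
    (fun v hv => mem_invariantVectors.2 fun i => hsH i v hv) ?_).symm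
  have := two_mul_finrank_invariantVectors (σ := ⟨s, s, hss, hss⟩) hss hs
  omega

end PairSubspace

section Count

lemma fixedPointFree_involution_iff_cycleType {ι : Type*} [Fintype ι] [DecidableEq ι]
    {k : ℕ} (hι : Fintype.card ι = 2 * k) (σ : Equiv.Perm ι) :
    ((∀ i, σ (σ i) = i) ∧ ∀ i, σ i ≠ i) ↔ σ.cycleType = Multiset.replicate k 2 := by
  have hsupp : (∀ i, σ i ≠ i) ↔ σ.support.card = 2 * k := by
    rw [← hι, Finset.card_eq_iff_eq_univ]
    simp [Finset.ext_iff]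
  have hsq : (∀ i, σ (σ i) = i) ↔ σ ^ 2 = 1 := by
    simp [Equiv.ext_iff, pow_two]
  rw [hsupp, hsq, Equiv.Perm.pow_prime_eq_one_iff, ← Equiv.Perm.sum_cycleType]
  constructor
  · rintro ⟨h, hsum⟩
    have h' := Multiset.eq_replicate_card.2 h
    rw [h', Multiset.sum_replicate, smul_eq_mul] at hsum
    rw [h', show σ.cycleType.card = k by omega]
  · intro h
    rw [h]
    exact ⟨fun c hc => Multiset.eq_of_mem_replicate hc, by simp [mul_comm]⟩

lemma card_fixedPointFree_involution (k : ℕ) :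
    Nat.card {σ : Equiv.Perm (Fin (2 * k)) // (∀ i, σ (σ i) = i) ∧ ∀ i, σ i ≠ i} =
      ∏ i ∈ Finset.range k, (2 * i + 1) := by
  have hfact : ∀ n : ℕ, (2 * n).factorial =
      (2 ^ n * n.factorial) * ∏ i ∈ Finset.range n, (2 * i + 1) := by
    intro n
    induction n with
    | zero => simp
    | succ n ih =>
      rw [Finset.prod_range_succ, show 2 * (n + 1) = 2 * n + 1 + 1 by ring, Nat.factorial_succ,
        Nat.factorial_succ, ih, Nat.factorial_succ]
      ring
  simp_rw [fixedPointFree_involution_iff_cycleType (Fintype.card_fin (2 * k))]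
  rw [Nat.card_eq_fintype_card, Fintype.card_subtype, Equiv.Perm.card_of_cycleType, if_pos]
  · have hcount : ∏ n ∈ (Multiset.replicate k 2).toFinset,
        ((Multiset.replicate k 2).count n).factorial = k.factorial := by
      rcases k.eq_zero_or_pos with rfl | hk
      · simp
      · rw [Multiset.toFinset_replicate, if_neg hk.ne']
        simp
    rw [hcount, Multiset.sum_replicate, Multiset.prod_replicate, Fintype.card_fin, hfact]
    simp only [smul_eq_mul, mul_comm k 2, Nat.sub_self, Nat.factorial_zero, one_mul]
    exact Nat.mul_div_cancel_left _ (by positivity)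
  · exact ⟨by simp [mul_comm], fun a ha => (Multiset.eq_of_mem_replicate ha).ge⟩

end Count

lemma crossSpan_subset_perpSet_iff {m : ℕ} {H : Submodule (ZMod 2) (Fin m → ZMod 2)} :
    (↑(crossSpan H) : Set (Fin m → ZMod 2)) ⊆ perpSet H ↔
      ∀ u ∈ H, ∀ v ∈ H, ∀ w ∈ H, ∑ j, w j * (u j * v j) = 0 := by
  have : perpSet H = dotOrthogonal H := by
    ext v
    exact mem_dotOrthogonal.symm
  rw [this, SetLike.coe_subset_coe, crossSpan, Submodule.span_le]
  constructor
  · intro h u hu v hv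
    exact mem_dotOrthogonal.1 (h ⟨u, hu, v, hv, rfl⟩)
  · rintro h _ ⟨u, hu, v, hv, rfl⟩
    exact mem_dotOrthogonal.2 (h u hu v hv)

/-- the number of subspaces `H ⊆ 𝔽₂^{2k}` with `dim H = k` and `H^× ⊆ H^⊥`
is the double factorial `(2k−1)!! = ∏_{i=1}^{k} (2i−1)`. -/
theorem stmt6 (k : ℕ) (hk : 1 ≤ k) :
    Nat.card {H : Submodule (ZMod 2) (Fin (2 * k) → ZMod 2) //
        Module.finrank (ZMod 2) H = k ∧
          (↑(crossSpan H) : Set (Fin (2 * k) → ZMod 2)) ⊆ perpSet H} =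
      ∏ i ∈ Finset.range k, (2 * i + 1) := by
  rw [← card_fixedPointFree_involution k]
  have hcard : Fintype.card (Fin (2 * k)) = 2 * k := Fintype.card_fin _
  refine (Nat.card_congr (Equiv.ofBijective
    (fun σ => ⟨invariantVectors σ.1, ?dim, crossSpan_subset_perpSet_iff.2 ?triple⟩) ⟨?_, ?_⟩)).symm
  case dim =>
    have := two_mul_finrank_invariantVectors σ.2.1 σ.2.2
    omega
  case triple =>
    exact fun u hu v hv w hw => sum_eq_zero_of_mem_invariantVectors σ.2.1 σ.2.2
      (mul_mem_invariantVectors hw (mul_mem_invariantVectors hu hv))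
  · intro σ τ h
    exact Subtype.ext (invariantVectors_injOn σ.2 τ.2 (congrArg Subtype.val h))
  · rintro ⟨H, hd, hH⟩
    obtain ⟨σ, hσ, h⟩ := exists_eq_invariantVectors (by omega) (crossSpan_subset_perpSet_iff.1 hH)
    exact ⟨⟨σ, hσ⟩, Subtype.ext h⟩
end

section
/- For every k ≥ 1, the number of 𝔽₂-linear subspaces H of 𝔽₂^{2k} with dim H = k and H ⊆ H^⊥ (i.e. the number of self-dual binary linear codes of length 2k) equals ∏_{j=1}^{k−1} (2^j + 1), with the empty product equal to 1 when k = 1. -/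
/-- The number of vectors of `U` outside a subspace `W ≤ U`, over a finite field. -/
theorem ncard_mem_notMem_of_le {K V : Type*} [Field K] [Fintype K] [AddCommGroup V] [Module K V]
    [FiniteDimensional K V] {W U : Submodule K V} (h : W ≤ U) :
    {v : V | v ∈ U ∧ v ∉ W}.ncard =
      Fintype.card K ^ Module.finrank K U - Fintype.card K ^ Module.finrank K W := by
  have : Finite V := Module.finite_of_finite K
  have key (S : Submodule K V) : (S : Set V).ncard = Fintype.card K ^ Module.finrank K S := by
    rw [← Nat.card_eq_fintype_card, ← Module.natCard_eq_pow_finrank (K := K) (V := S)]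
    rfl
  rw [← key, ← key, ← Set.ncard_sdiff (SetLike.coe_subset_coe.2 h)]
  rfl

/-- The totally isotropic subspaces of dimension `k` containing `W`. -/
def lagrangiansAbove {K V : Type*} [Field K] [AddCommGroup V] [Module K V]
    (B : LinearMap.BilinForm K V) (k : ℕ) (W : Submodule K V) : Set (Submodule K V) :=
  {H | Module.finrank K H = k ∧ H ≤ B.orthogonal H ∧ W ≤ H}

/-- If `W` is totally isotropic of dimension `k - n` in a nondegenerate symmetric space of dimension
`2k`, and all vectors of `Wᗮ` are isotropic, then exactly `∏ (q ^ j + 1)`, `1 ≤ j ≤ n`, totally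
isotropic subspaces of dimension `k` contain `W`. -/
theorem ncard_lagrangiansAbove {K V : Type*} [Field K] [Fintype K] [AddCommGroup V] [Module K V]
    [FiniteDimensional K V] (B : LinearMap.BilinForm K V) (hB : B.Nondegenerate) (hs : B.IsSymm)
    (k : ℕ) (hV : Module.finrank K V = 2 * k) (n : ℕ) (W : Submodule K V)
    (hW : W ≤ B.orthogonal W) (hiso : ∀ v ∈ B.orthogonal W, B v v = 0)
    (hn : Module.finrank K W + n = k) :
    (lagrangiansAbove B k W).ncard = ∏ j ∈ Finset.range n, (Fintype.card K ^ (j + 1) + 1) := by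
  classical
  have : Finite V := Module.finite_of_finite K
  have : Finite (Submodule K V) := Finite.of_injective _ SetLike.coe_injective
  induction n generalizing W with
  | zero =>
    have : lagrangiansAbove B k W = {W} := by
      ext H
      simp only [lagrangiansAbove, Set.mem_ofPred_eq, Set.mem_singleton_iff]
      constructor
      · rintro ⟨h1, -, h3⟩
        exact (Submodule.eq_of_le_of_finrank_eq h3 (by omega)).symm
      · rintro rfl
        exact ⟨by omega, hW, le_rfl⟩
    simp [this]
  | succ n ih =>
    have := Fintype.ofFinite V
    have := Fintype.ofFinite (Submodule K V)
    have hq : 1 < Fintype.card K := Fintype.one_lt_card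
    have hperp : Module.finrank K (B.orthogonal W) = 2 * k - Module.finrank K W := by
      rw [LinearMap.BilinForm.finrank_orthogonal hB, hV]
    have key := Finset.card_mul_eq_card_mul (fun (H : Submodule K V) (v : V) => v ∈ H)
      (s := (lagrangiansAbove B k W).toFinset)
      (t := {v : V | v ∈ B.orthogonal W ∧ v ∉ W}.toFinset)
      (m := Fintype.card K ^ k - Fintype.card K ^ Module.finrank K W)
      (n := ∏ j ∈ Finset.range n, (Fintype.card K ^ (j + 1) + 1)) ?_ ?_
    · rw [← Set.ncard_eq_toFinset_card', ← Set.ncard_eq_toFinset_card',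
        ncard_mem_notMem_of_le hW, hperp] at key
      set q := Fintype.card K
      set d := Module.finrank K W
      have h1 : q ^ k - q ^ d = q ^ d * (q ^ (n + 1) - 1) := by
        rw [← hn, pow_add, Nat.mul_sub, mul_one]
      have h2 : q ^ (2 * k - d) - q ^ d = q ^ d * (q ^ (n + 1) - 1) * (q ^ (n + 1) + 1) := by
        have : 2 * k - d = d + ((n + 1) + (n + 1)) := by omega
        rw [this, pow_add, mul_assoc, mul_comm (q ^ (n + 1) - 1), ← Nat.sq_sub_sq _ 1,
          Nat.mul_sub, pow_add, one_pow, mul_one, sq]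
      have hpos : 0 < q ^ d * (q ^ (n + 1) - 1) :=
        Nat.mul_pos (by positivity) (Nat.sub_pos_of_lt (Nat.one_lt_pow (by omega) hq))
      rw [h1, h2] at key
      rw [Finset.prod_range_succ]
      apply Nat.eq_of_mul_eq_mul_right hpos
      rw [key]
      ring
    · intro H hH
      obtain ⟨h1, h2, h3⟩ := Set.mem_toFinset.1 hH
      rw [← h1, ← ncard_mem_notMem_of_le h3, Set.ncard_eq_toFinset_card']
      congr 1
      ext v
      simp only [Finset.mem_bipartiteAbove, Set.mem_toFinset, Set.mem_ofPred_eq]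
      have : v ∈ H → v ∈ B.orthogonal W := fun hv => LinearMap.BilinForm.orthogonal_le h3 (h2 hv)
      tauto
    · intro v hv
      obtain ⟨hv1, hv2⟩ := Set.mem_toFinset.1 hv
      have hv0 : v ≠ 0 := by
        rintro rfl
        exact hv2 W.zero_mem
      have hvv := hiso v hv1
      have hdim : Module.finrank K ↥(W ⊔ K ∙ v) = Module.finrank K W + 1 := by
        have h := Submodule.finrank_sup_add_finrank_inf_eq W (K ∙ v)
        rw [(Submodule.disjoint_span_singleton' hv0).2 hv2 |>.eq_bot, finrank_bot,
          finrank_span_singleton hv0] at h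
        simpa using h
      rw [← ih (W ⊔ K ∙ v) ?_ ?_ (by omega), Set.ncard_eq_toFinset_card']
      · congr 1
        ext H
        rw [Finset.mem_bipartiteBelow, Set.mem_toFinset, Set.mem_toFinset]
        simp only [lagrangiansAbove, Set.mem_ofPred_eq, sup_le_iff,
          Submodule.span_singleton_le_iff_mem]
        tauto
      · intro x hx y hy
        obtain ⟨w, hw, a, ha, rfl⟩ := Submodule.mem_sup.1 hx
        obtain ⟨w', hw', b, hb, rfl⟩ := Submodule.mem_sup.1 hy
        obtain ⟨a, rfl⟩ := Submodule.mem_span_singleton.1 ha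
        obtain ⟨b, rfl⟩ := Submodule.mem_span_singleton.1 hb
        have e1 : B w' w = 0 := hW hw w' hw'
        have e2 : B w' v = 0 := hv1 w' hw'
        have e3 : B v w = 0 := by rw [hs.eq]; exact hv1 w hw
        simp [e1, e2, e3, hvv]
      · exact fun x hx => hiso x (LinearMap.BilinForm.orthogonal_le le_sup_left hx)

/-- the number of self-dual binary codes of length `2k`, i.e. subspaces
`H ⊆ 𝔽₂^{2k}` with `dim H = k` and `H ⊆ H^⊥`, equals `∏_{j=1}^{k−1} (2^j + 1)`. -/
theorem stmt7 (k : ℕ) (hk : 1 ≤ k) :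
    Nat.card {H : Submodule (ZMod 2) (Fin (2 * k) → ZMod 2) //
        Module.finrank (ZMod 2) H = k ∧
          (H : Set (Fin (2 * k) → ZMod 2)) ⊆ perpSet H} =
      ∏ j ∈ Finset.range (k - 1), (2 ^ (j + 1) + 1) := by
  have hV : Module.finrank (ZMod 2) (Fin (2 * k) → ZMod 2) = 2 * k := by simp
  let B : LinearMap.BilinForm (ZMod 2) (Fin (2 * k) → ZMod 2) := dotProductBilin (ZMod 2) (ZMod 2)
  have hBdef (u v : Fin (2 * k) → ZMod 2) : B u v = ∑ j, u j * v j := rfl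
  have hs : B.IsSymm := ⟨fun u v => by simp [hBdef, mul_comm]⟩
  have hB : B.Nondegenerate := by
    refine hs.isRefl.nondegenerate_iff_separatingLeft.2 ?_
    intro u hu
    ext i
    simpa [hBdef, Pi.single_apply] using hu (Pi.single i 1)
  have hone (v : Fin (2 * k) → ZMod 2) : B 1 v = B v v := by
    have h2 : ∀ a : ZMod 2, a = a * a := by decide
    simp only [hBdef, Pi.one_apply, one_mul]
    exact Finset.sum_congr rfl fun j _ => h2 _
  have h11 : B 1 1 = 0 := by
    simp [hBdef, show (2 : ZMod 2) = 0 from rfl]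
  have hne : (1 : Fin (2 * k) → ZMod 2) ≠ 0 := fun h => by
    simpa using congrFun h ⟨0, by omega⟩
  have hcount := ncard_lagrangiansAbove B hB hs k hV (k - 1) (ZMod 2 ∙ 1)
    (by
      rw [Submodule.span_singleton_le_iff_mem]
      intro u hu
      obtain ⟨a, rfl⟩ := Submodule.mem_span_singleton.1 hu
      simp [h11])
    (fun v hv => by
      rw [← hone]
      exact hv 1 (Submodule.mem_span_singleton_self 1))
    (by rw [finrank_span_singleton hne]; omega)
  rw [ZMod.card] at hcount
  rw [← hcount, ← Nat.card_coe_set_eq]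
  congr! 3 with H
  have hperp : (H : Set (Fin (2 * k) → ZMod 2)) ⊆ perpSet H ↔ H ≤ B.orthogonal H := Iff.rfl
  rw [hperp]
  refine ⟨fun ⟨h1, h2⟩ => ⟨h1, h2, ?_⟩, fun ⟨h1, h2, _⟩ => ⟨h1, h2⟩⟩
  rw [Submodule.span_singleton_le_iff_mem, Submodule.eq_of_le_of_finrank_eq h2
    (by rw [LinearMap.BilinForm.finrank_orthogonal hB, hV]; omega)]
  intro u hu
  rw [hs.eq, hone]
  exact h2 hu u hu
end

section
/- Let l ≥ 1 be an integer. For every integer m, let Q_l(m) = 1 − (1−m)^l · ∑_{j=0}^{l−1} C(l+j−1, j) m^j ∈ ℤ, where C(·,·) is the binomial coefficient. If m is even then Q_l(m) ≡ 0 (mod 2^l), and if m is odd then Q_l(m) ≡ 1 (mod 2^l). -/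
/-- The Beigel–Tarui modulus-amplifying polynomial
`Q_l(m) = 1 − (1−m)^l ∑_{j=0}^{l−1} C(l+j−1, j) m^j`. -/
def Qpoly (l : ℕ) (m : ℤ) : ℤ :=
  1 - (1 - m) ^ l * ∑ j ∈ Finset.range l, ((l + j - 1).choose j : ℤ) * m ^ j

theorem one_sub_mul_sum_range_choose {R : Type*} [CommRing R] (x : R) (d n : ℕ) :
    (1 - x) * ∑ j ∈ Finset.range n, ((d + 1 + j).choose (d + 1) : R) * x ^ j =
      ∑ j ∈ Finset.range n, ((d + j).choose d : R) * x ^ j - (d + n).choose (d + 1) * x ^ n := by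
  induction n with
  | zero => simp
  | succ n ih =>
    have pascal : ((d + 1 + n).choose (d + 1) : R) =
        (d + n).choose d + (d + n).choose (d + 1) := by
      rw [add_right_comm, Nat.choose_succ_succ]
      push_cast
      rfl
    rw [Finset.sum_range_succ, Finset.sum_range_succ, mul_add, ih,
      show d + (n + 1) = d + 1 + n by omega, pascal]
    ring

/-- The truncation to degree below `n` of the expansion of `(1 - x) ^ (-(d + 1))` inverts
`(1 - x) ^ (d + 1)` modulo `x ^ n`. -/
theorem pow_dvd_one_sub_mul_sum_range_choose {R : Type*} [CommRing R] (x : R) (d n : ℕ) :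
    x ^ n ∣ 1 - (1 - x) ^ (d + 1) * ∑ j ∈ Finset.range n, ((d + j).choose d : R) * x ^ j := by
  induction d with
  | zero => simp [mul_neg_geom_sum]
  | succ d ih =>
    rw [pow_succ, mul_assoc, one_sub_mul_sum_range_choose, mul_sub, ← sub_add]
    exact dvd_add ih (((dvd_refl _).mul_left _).mul_left _)

theorem pow_dvd_Qpoly {l : ℕ} (hl : 1 ≤ l) (m : ℤ) : m ^ l ∣ Qpoly l m := by
  obtain ⟨d, rfl⟩ := Nat.exists_eq_add_of_le' hl
  have h : Qpoly (d + 1) m = 1 - (1 - m) ^ (d + 1) *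
      ∑ j ∈ Finset.range (d + 1), ((d + j).choose d : ℤ) * m ^ j := by
    unfold Qpoly
    congr 2
    refine Finset.sum_congr rfl fun j _ => ?_
    rw [show d + 1 + j - 1 = d + j by omega, Nat.choose_symm_add]
  rw [h]
  exact pow_dvd_one_sub_mul_sum_range_choose m d (d + 1)

/-- for `l ≥ 1`, if `m` is even then `Q_l(m) ≡ 0 (mod 2^l)`, and if `m` is
odd then `Q_l(m) ≡ 1 (mod 2^l)`. -/
theorem stmt17 (l : ℕ) (hl : 1 ≤ l) (m : ℤ) :
    (Even m → (2 : ℤ) ^ l ∣ Qpoly l m) ∧ (Odd m → (2 : ℤ) ^ l ∣ Qpoly l m - 1) := by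
  refine ⟨fun hm => (pow_dvd_pow_of_dvd hm.two_dvd l).trans (pow_dvd_Qpoly hl m), fun hm => ?_⟩
  have h : (2 : ℤ) ∣ 1 - m := (odd_one.sub_odd hm).two_dvd
  rw [Qpoly, sub_sub_cancel_left, dvd_neg]
  exact (pow_dvd_pow_of_dvd h l).mul_right _
end
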